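/- Let h1, h2 and w be positive integers such that 3w ≤ h2 ≤ C(h1+1,2). Then there exists a 2-dimensional connected Buchsbaum simplicial complex Δ with h-vector h(Δ) = (1, h1, h2, −w). -/

import Mathlib

open Finset

noncomputable section

/-- `Δ` is a simplicial complex on `[n] = {1,…,n}`: a collection of subsets of `[n]`,
closed under taking subsets, containing every singleton `{i}` for `i ∈ [n]`. -/
def IsComplexOn (n : ℕ) (Δ : Finset (Finset ℕ)) : Prop :=
  (∀ F ∈ Δ, ∀ G ⊆ F, G ∈ Δ) ∧
  (∀ F ∈ Δ, ∀ i ∈ F, i ∈ Finset.Icc 1 n) ∧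
  (∀ i ∈ Finset.Icc 1 n, ({i} : Finset ℕ) ∈ Δ)

/-- a simplicial complex whose vertex set is contained in `[n]`:
a downward closed collection of subsets of `[n]`. -/
def IsComplexIn (n : ℕ) (Δ : Finset (Finset ℕ)) : Prop :=
  (∀ F ∈ Δ, ∀ G ⊆ F, G ∈ Δ) ∧ (∀ F ∈ Δ, ∀ i ∈ F, i ∈ Finset.Icc 1 n)

/-- the faces of `Δ` with `m` vertices -/
def facesOf (Δ : Finset (Finset ℕ)) (m : ℕ) : Finset (Finset ℕ) :=
  Δ.filter fun F => F.card = m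

/-- `fVec Δ j = f_{j-1}(Δ)`, the number of faces of `Δ` with `j` vertices;
by convention `f_{-1}(Δ) = 1`. -/
def fVec (Δ : Finset (Finset ℕ)) (j : ℕ) : ℤ :=
  if j = 0 then 1 else ((facesOf Δ j).card : ℤ)

/-- the `h`-vector of a `(d-1)`-dimensional complex, defined by
`∑ f_{i-1} (x-1)^{d-i} = ∑ h_i x^{d-i}`, i.e.
`h_i = ∑_{j=0}^{i} (-1)^{i-j} C(d-j, i-j) f_{j-1}`. -/
def hVec (d : ℕ) (Δ : Finset (Finset ℕ)) (i : ℕ) : ℤ :=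
  ∑ j ∈ Finset.range (i + 1),
    (-1 : ℤ) ^ (i - j) * ((d - j).choose (i - j) : ℤ) * fVec Δ j

/-- the dimension `max {k : f_k(Δ) ≠ 0}` of `Δ`, as an integer -/
def dimZ (Δ : Finset (Finset ℕ)) : ℤ := ((Δ.sup Finset.card : ℕ) : ℤ) - 1

/-- the link `lk_Δ(F) = {G : G ∩ F = ∅, G ∪ F ∈ Δ}` -/
def link (Δ : Finset (Finset ℕ)) (F : Finset ℕ) : Finset (Finset ℕ) :=
  Δ.filter fun G => Disjoint G F ∧ G ∪ F ∈ Δ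

variable (K : Type) [Field K]

/-- the simplicial boundary operator on formal `K`-linear combinations of
finite subsets of `ℕ` (vertices ordered by the order on `ℕ`):
`∂ F = ∑_{v ∈ F} (-1)^{#{u ∈ F : u < v}} (F \ {v})`. -/
def bdry : (Finset ℕ →₀ K) →ₗ[K] (Finset ℕ →₀ K) :=
  Finsupp.lsum K fun F => LinearMap.toSpanSingleton K (Finset ℕ →₀ K)
    (∑ v ∈ F, ((-1 : K) ^ ((F.filter fun u => u < v).card)) • Finsupp.single (F.erase v) (1 : K))

/-- the space of simplicial `K`-chains of `Δ` spanned by the faces with `m` vertices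
(for `m = 0` this is the span of the empty face, giving *reduced* homology) -/
def chains (Δ : Finset (Finset ℕ)) (m : ℕ) : Submodule K (Finset ℕ →₀ K) :=
  Submodule.span K ((fun F => Finsupp.single F (1 : K)) '' (facesOf Δ m : Set (Finset ℕ)))

/-- the dimension of the reduced homology of `Δ` at faces of cardinality `m`:
`dim (ker ∂ ∩ C_m) - dim (∂ C_{m+1})` -/
def homDim (Δ : Finset (Finset ℕ)) (m : ℕ) : ℕ :=
  Module.finrank K ↥(chains K Δ m ⊓ LinearMap.ker (bdry K))
    - Module.finrank K ↥((chains K Δ (m + 1)).map (bdry K))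

/-- the reduced Betti number `β_i(Δ; K) = dim_K H̃_i(Δ; K)` for `i : ℤ` -/
def betti (Δ : Finset (Finset ℕ)) (i : ℤ) : ℕ :=
  if 0 ≤ i + 1 then homDim K Δ (i + 1).toNat else 0

/-- all facets (maximal faces) of `Δ` have the same cardinality -/
def IsPure (Δ : Finset (Finset ℕ)) : Prop :=
  ∀ F ∈ Δ, (∀ G ∈ Δ, F ⊆ G → F = G) → F.card = Δ.sup Finset.card

/-- `Δ` is Cohen–Macaulay (over `K`): for every face `F ∈ Δ` (including `∅`),
`β_i(lk_Δ(F)) = 0` for all `i ≠ dim Δ - |F|`. -/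
def IsCohenMacaulay (Δ : Finset (Finset ℕ)) : Prop :=
  ∀ F ∈ Δ, ∀ i : ℤ, i ≠ dimZ Δ - F.card → betti K (link Δ F) i = 0

/-- `Δ` is Buchsbaum (over `K`): `Δ` is pure and the link of every vertex is
Cohen–Macaulay. -/
def IsBuchsbaum (Δ : Finset (Finset ℕ)) : Prop :=
  IsPure Δ ∧ ∀ v : ℕ, ({v} : Finset ℕ) ∈ Δ → IsCohenMacaulay K (link Δ {v})

/-- `Δ` is connected: any two vertices are joined by a path of edges of `Δ` -/
def IsConnectedComplex (Δ : Finset (Finset ℕ)) : Prop :=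
  ∀ u v : ℕ, ({u} : Finset ℕ) ∈ Δ → ({v} : Finset ℕ) ∈ Δ →
    Relation.ReflTransGen (fun a b : ℕ => a ≠ b ∧ ({a, b} : Finset ℕ) ∈ Δ) u v

/-- `Δ` is link-acyclic: `β_i(lk_Δ(v)) = 0` for every vertex `v` of `Δ` and every `i` -/
def IsLinkAcyclic (Δ : Finset (Finset ℕ)) : Prop :=
  ∀ v : ℕ, ({v} : Finset ℕ) ∈ Δ → ∀ i : ℤ, betti K (link Δ {v}) i = 0

/-- `Δ` is `2`-dimensional with `h`-vector `(a, b, c, e)` -/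
def hVector3 (Δ : Finset (Finset ℕ)) (a b c e : ℤ) : Prop :=
  hVec 3 Δ 0 = a ∧ hVec 3 Δ 1 = b ∧ hVec 3 Δ 2 = c ∧ hVec 3 Δ 3 = e

/-- `macaulay2 a = a^⟨2⟩`: if `a = C(b,2) + r` is the (greedy) `2`-nd Macaulay
representation (`b` maximal with `C(b,2) ≤ a`, `0 ≤ r < b`, `r = C(r,1)`), then
`a^⟨2⟩ = C(b+1,3) + C(r+1,2)`, and `0^⟨2⟩ = 0`. -/
def macaulay2 (a : ℕ) : ℕ :=
  if a = 0 then 0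
  else
    (Nat.findGreatest (fun t => t.choose 2 ≤ a) (a + 2) + 1).choose 3
      + (a - (Nat.findGreatest (fun t => t.choose 2 ≤ a) (a + 2)).choose 2 + 1).choose 2

/-- `modRep n i = ī`, the unique element of `[n] = {1,…,n}` congruent to `i` mod `n` -/
def modRep (n : ℕ) (i : ℤ) : ℕ := ((i - 1) % (n : ℤ)).toNat + 1


end

lemma card_facesOf_insert {Δ : Finset (Finset ℕ)} {F : Finset ℕ} (hF : F ∉ Δ) (m : ℕ) :
    (facesOf (insert F Δ) m).card = (facesOf Δ m).card + if F.card = m then 1 else 0 := by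
  unfold facesOf
  rw [Finset.filter_insert]
  split_ifs with h
  · rw [Finset.card_insert_of_notMem (by simp [hF])]
  · simp

lemma IsComplexOn.insert_face {n : ℕ} {Δ : Finset (Finset ℕ)} (hΔ : IsComplexOn n Δ)
    {F : Finset ℕ} (hF : ∀ i ∈ F, i ∈ Finset.Icc 1 n) (hb : ∀ x ∈ F, F.erase x ∈ Δ) :
    IsComplexOn n (insert F Δ) := by
  obtain ⟨h1, h2, h3⟩ := hΔ
  refine ⟨fun A hA G hG => ?_, fun A hA => ?_, fun i hi => Finset.mem_insert_of_mem (h3 i hi)⟩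
  · rcases Finset.mem_insert.1 hA with rfl | hA
    · by_cases hGA : G = A
      · simp [hGA]
      · obtain ⟨x, hx, hxG⟩ := Finset.exists_of_ssubset (lt_of_le_of_ne hG hGA)
        exact Finset.mem_insert_of_mem (h1 _ (hb x hx) G (Finset.subset_erase.2 ⟨hG, hxG⟩))
    · exact Finset.mem_insert_of_mem (h1 A hA G hG)
  · rcases Finset.mem_insert.1 hA with rfl | hA
    · exact hF
    · exact h2 A hA

lemma IsComplexOn.insert_vertex {n : ℕ} {Δ : Finset (Finset ℕ)} (hΔ : IsComplexOn n Δ)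
    (h0 : ∅ ∈ Δ) : IsComplexOn (n + 1) (insert {n + 1} Δ) := by
  obtain ⟨h1, h2, h3⟩ := hΔ
  refine ⟨fun A hA G hG => ?_, fun A hA i hi => ?_, fun i hi => ?_⟩
  · rcases Finset.mem_insert.1 hA with rfl | hA
    · rcases Finset.subset_singleton_iff.1 hG with rfl | rfl
      · exact Finset.mem_insert_of_mem h0
      · simp
    · exact Finset.mem_insert_of_mem (h1 A hA G hG)
  · rcases Finset.mem_insert.1 hA with rfl | hA
    · simp at hi ⊢; omega
    · have := h2 A hA i hi
      simp at this ⊢; omega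
  · by_cases h : i = n + 1
    · simp [h]
    · refine Finset.mem_insert_of_mem (h3 i ?_)
      simp at hi ⊢; omega

lemma IsComplexOn.insert_edge {n : ℕ} {Δ : Finset (Finset ℕ)} (hΔ : IsComplexOn n Δ)
    {a b : ℕ} (ha : {a} ∈ Δ) (hb : {b} ∈ Δ) : IsComplexOn n (insert {a, b} Δ) := by
  refine hΔ.insert_face (fun i hi => ?_) fun x hx => ?_
  · rcases Finset.mem_insert.1 hi with rfl | hi
    · exact hΔ.2.1 _ ha i (by simp)
    · exact hΔ.2.1 _ hb i hi
  · simp only [Finset.mem_insert, Finset.mem_singleton] at hx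
    rcases hx with rfl | rfl
    · exact hΔ.1 _ hb _ (by intro y; simp)
    · exact hΔ.1 _ ha _ (by intro y; simp; tauto)

lemma IsComplexOn.insert_triangle {n : ℕ} {Δ : Finset (Finset ℕ)} (hΔ : IsComplexOn n Δ)
    {a b c : ℕ} (hab : {a, b} ∈ Δ) (hac : {a, c} ∈ Δ) (hbc : {b, c} ∈ Δ) :
    IsComplexOn n (insert {a, b, c} Δ) := by
  refine hΔ.insert_face (fun i hi => ?_) fun x hx => ?_
  · rcases Finset.mem_insert.1 hi with rfl | hi
    · exact hΔ.2.1 _ hab i (by simp)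
    · exact hΔ.2.1 _ hbc i hi
  · simp only [Finset.mem_insert, Finset.mem_singleton] at hx
    rcases hx with rfl | rfl | rfl
    · exact hΔ.1 _ hbc _ (by intro y; simp)
    · exact hΔ.1 _ hac _ (by intro y; simp; tauto)
    · exact hΔ.1 _ hab _ (by intro y; simp; tauto)

lemma card_triple {a b c : ℕ} (hab : a ≠ b) (hac : a ≠ c) (hbc : b ≠ c) :
    ({a, b, c} : Finset ℕ).card = 3 := Finset.card_eq_three.2 ⟨a, b, c, hab, hac, hbc, rfl⟩

lemma ne_of_card_ne {A B : Finset ℕ} {i j : ℕ} (hA : A.card = i) (hB : B.card = j)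
    (hij : i ≠ j) : A ≠ B := by
  rintro rfl
  exact hij (hA.symm.trans hB)

lemma pair_ne_triple {a b c p q : ℕ} (hab : a ≠ b) (hac : a ≠ c) (hbc : b ≠ c) :
    ({p, q} : Finset ℕ) ≠ {a, b, c} := fun e => by
  have h1 := card_triple hab hac hbc
  have h2 : ({p, q} : Finset ℕ).card ≤ 2 := Finset.card_le_two
  rw [e] at h2
  omega

lemma pair_eq_pair {a b c d : ℕ} (h : ({a, b} : Finset ℕ) = {c, d}) :
    (a = c ∧ b = d) ∨ (a = d ∧ b = c) := by
  have := congrArg (fun s : Finset ℕ => (s : Set ℕ)) h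
  simp only [Finset.coe_pair] at this
  exact Set.pair_eq_pair_iff.1 this

/-- Adjacency in the link of `v`. -/
def LinkAdj (Δ : Finset (Finset ℕ)) (v p q : ℕ) : Prop :=
  p ≠ v ∧ q ≠ v ∧ p ≠ q ∧ ({v, p, q} : Finset ℕ) ∈ Δ

lemma LinkAdj.symm {Δ : Finset (Finset ℕ)} {v p q : ℕ} (h : LinkAdj Δ v p q) :
    LinkAdj Δ v q p :=
  ⟨h.2.1, h.1, h.2.2.1.symm, by rw [Finset.pair_comm q p]; exact h.2.2.2⟩

/-- A complex of dimension at most two on `[n]` that contains the fan with apex `1` over the path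
`2, …, n`, all of whose vertex links are connected, with `h`-vector `(1, n - 3, s, -w)`. -/
structure IsFanComplex (n s w : ℕ) (Δ : Finset (Finset ℕ)) : Prop where
  two_le : 2 ≤ n
  complex : IsComplexOn n Δ
  card_le : ∀ F ∈ Δ, F.card ≤ 3
  fan : ∀ i, 2 ≤ i → i + 1 ≤ n → ({1, i, i + 1} : Finset ℕ) ∈ Δ
  cone : ∀ i, 2 ≤ i → i ≤ n → ({1, i} : Finset ℕ) ∈ Δ
  link_connected : ∀ v x, 2 ≤ v → x ≠ v → ({v, x} : Finset ℕ) ∈ Δ →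
    Relation.ReflTransGen (LinkAdj Δ v) x 1
  card_one : (facesOf Δ 1).card = n
  card_two : (facesOf Δ 2).card + 3 = 2 * n + s
  card_three : (facesOf Δ 3).card + w + 2 = n + s

namespace IsFanComplex

variable {n s w : ℕ} {Δ : Finset (Finset ℕ)}

lemma empty_mem (h : IsFanComplex n s w Δ) : ∅ ∈ Δ :=
  h.complex.1 _ (h.cone 2 le_rfl h.two_le) _ (Finset.empty_subset _)

lemma path_mem (h : IsFanComplex n s w Δ) {i : ℕ} (hi : 2 ≤ i) (hn : i + 1 ≤ n) :
    ({i, i + 1} : Finset ℕ) ∈ Δ :=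
  h.complex.1 _ (h.fan i hi hn) _ (Finset.subset_insert _ _)

lemma notMem_of_lt (h : IsFanComplex n s w Δ) {F : Finset ℕ} {i : ℕ} (hi : i ∈ F)
    (hn : n < i) : F ∉ Δ := fun hF => by
  have := h.complex.2.1 F hF i hi
  simp at this; omega

lemma singleton_mem (h : IsFanComplex n s w Δ) {i : ℕ} (hi : 1 ≤ i) (hn : i ≤ n) :
    ({i} : Finset ℕ) ∈ Δ := h.complex.2.2 i (by simp; omega)

lemma reach_mono {Δ' : Finset (Finset ℕ)} (hsub : Δ ⊆ Δ') {v x y : ℕ}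
    (h : Relation.ReflTransGen (LinkAdj Δ v) x y) : Relation.ReflTransGen (LinkAdj Δ' v) x y :=
  Relation.ReflTransGen.mono (fun _ _ hab => ⟨hab.1, hab.2.1, hab.2.2.1, hsub hab.2.2.2⟩) _ _ h

lemma isFanComplex_two : IsFanComplex 2 0 0 {∅, {1}, {2}, {1, 2}} where
  two_le := le_rfl
  complex := by
    refine ⟨by decide, by decide, by decide⟩
  card_le := by decide
  fan i hi hn := by omega
  cone i hi hn := by
    obtain rfl : i = 2 := by omega
    decide
  link_connected v x hv hx hvx := by
    have : x = 1 := by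
      simp only [Finset.mem_insert, Finset.mem_singleton] at hvx
      rcases hvx with h | h | h | h
      · simp at h
      · have := congrArg (v ∈ ·) h
        simp at this; omega
      · have h1 := congrArg (v ∈ ·) h
        have h2 := congrArg (x ∈ ·) h
        simp at h1 h2; omega
      · rcases pair_eq_pair h with h | h <;> omega
    rw [this]
  card_one := by decide
  card_two := by decide
  card_three := by decide

lemma notMem_triple (h : IsComplexOn n Δ) {a b c : ℕ} (hab : ({a, b} : Finset ℕ) ∉ Δ) :
    ({a, b, c} : Finset ℕ) ∉ Δ := fun e =>
  hab (h.1 _ e _ (by intro y; simp; tauto))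

/-- Glue a triangle with a new vertex along the edge `{1, n}`. -/
lemma exists_add_vertex (h : IsFanComplex n s w Δ) :
    ∃ Δ', IsFanComplex (n + 1) s w Δ' ∧
      ∀ p q, ({p, q} : Finset ℕ) ∈ Δ' → 2 ≤ q → q + 2 ≤ p → ({p, q} : Finset ℕ) ∈ Δ := by
  have hn := h.two_le
  have c0 : ({n + 1} : Finset ℕ).card = 1 := rfl
  have c1 : ({1, n + 1} : Finset ℕ).card = 2 := Finset.card_pair (by omega)
  have c2 : ({n, n + 1} : Finset ℕ).card = 2 := Finset.card_pair (by omega)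
  have c3 : ({1, n, n + 1} : Finset ℕ).card = 3 := card_triple (by omega) (by omega) (by omega)
  have n0 : ({n + 1} : Finset ℕ) ∉ Δ := h.notMem_of_lt (i := n + 1) (by simp) (by omega)
  have n1 : ({1, n + 1} : Finset ℕ) ∉ insert {n + 1} Δ := by
    simp only [Finset.mem_insert, not_or]
    exact ⟨ne_of_card_ne c1 c0 (by omega), h.notMem_of_lt (i := n + 1) (by simp) (by omega)⟩
  have n2 : ({n, n + 1} : Finset ℕ) ∉ insert {1, n + 1} (insert {n + 1} Δ) := by
    simp only [Finset.mem_insert, not_or]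
    exact ⟨fun e => by rcases pair_eq_pair e with e | e <;> omega,
      ne_of_card_ne c2 c0 (by omega), h.notMem_of_lt (i := n + 1) (by simp) (by omega)⟩
  have n3 : ({1, n, n + 1} : Finset ℕ) ∉
      insert {n, n + 1} (insert {1, n + 1} (insert {n + 1} Δ)) := by
    simp only [Finset.mem_insert, not_or]
    exact ⟨ne_of_card_ne c3 c2 (by omega), ne_of_card_ne c3 c1 (by omega),
      ne_of_card_ne c3 c0 (by omega), h.notMem_of_lt (i := n + 1) (by simp) (by omega)⟩
  set Δ' := insert {1, n, n + 1} (insert {n, n + 1} (insert {1, n + 1} (insert {n + 1} Δ)))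
    with hΔ'
  have hsub : Δ ⊆ Δ' := fun F hF => by simp [hΔ', hF]
  have hT : ({1, n, n + 1} : Finset ℕ) ∈ Δ' := by simp [hΔ']
  have hpair : ∀ p q, ({p, q} : Finset ℕ) ∈ Δ' → p ≠ q → ({p, q} : Finset ℕ) ∈ Δ ∨
      (p = n ∧ q = n + 1) ∨ (p = n + 1 ∧ q = n) ∨ (p = 1 ∧ q = n + 1) ∨
        (p = n + 1 ∧ q = 1) := by
    intro p q hpq hne
    simp only [hΔ', Finset.mem_insert] at hpq
    rcases hpq with e | e | e | e | e
    · exact absurd e (pair_ne_triple (by omega) (by omega) (by omega))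
    · rcases pair_eq_pair e with e | e <;> omega
    · rcases pair_eq_pair e with e | e <;> omega
    · exact absurd e (ne_of_card_ne (Finset.card_pair hne) c0 (by omega))
    · exact Or.inl e
  refine ⟨Δ', ?_, fun p q hpq hq hqp => ?_⟩
  swap
  · rcases hpair p q hpq (by omega) with e | e
    · exact e
    · omega
  refine ⟨by omega, ?_, ?_, ?_, ?_, ?_, ?_, ?_, ?_⟩
  · refine IsComplexOn.insert_triangle (IsComplexOn.insert_edge (IsComplexOn.insert_edge
      (h.complex.insert_vertex h.empty_mem) ?_ ?_) ?_ ?_) ?_ ?_ ?_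
    · simp [h.singleton_mem le_rfl (by omega : 1 ≤ n)]
    · simp
    · simp [h.singleton_mem (by omega : 1 ≤ n) le_rfl]
    · simp
    · simp [h.cone n hn le_rfl]
    · simp
    · simp
  · intro F hF
    simp only [hΔ', Finset.mem_insert] at hF
    rcases hF with rfl | rfl | rfl | rfl | hF
    · omega
    · omega
    · omega
    · omega
    · exact h.card_le F hF
  · intro i hi hin
    rcases Nat.lt_or_ge i n with hi' | hi'
    · exact hsub (h.fan i hi hi')
    · obtain rfl : i = n := by omega
      exact hT
  · intro i hi hin
    rcases Nat.lt_or_ge n i with hi' | hi'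
    · obtain rfl : i = n + 1 := by omega
      simp [hΔ']
    · exact hsub (h.cone i hi hi')
  · intro v x hv hx hvx
    rcases hpair v x hvx hx.symm with e | ⟨rfl, rfl⟩ | ⟨rfl, rfl⟩ | ⟨rfl, rfl⟩ | ⟨rfl, rfl⟩
    · exact reach_mono hsub (h.link_connected v x hv hx e)
    · refine .single ⟨by omega, by omega, by omega, ?_⟩
      convert hT using 1
      ext; simp; tauto
    · refine .single ⟨by omega, by omega, by omega, ?_⟩
      convert hT using 1
      ext; simp; tauto
    · omega
    · exact .refl
  all_goals
    rw [hΔ', card_facesOf_insert n3, card_facesOf_insert n2, card_facesOf_insert n1,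
      card_facesOf_insert n0, c0, c1, c2, c3]
    have := h.card_one
    have := h.card_two
    have := h.card_three
    norm_num
    omega

/-- Fill in a missing edge `{i, j}` with the triangle `{1, i, j}`. -/
lemma exists_add_edge (h : IsFanComplex n s w Δ) {i j : ℕ} (hi : 2 ≤ i) (hin : i ≤ n)
    (hj : 2 ≤ j) (hjn : j ≤ n) (hij : i ≠ j) (hΔ : ({i, j} : Finset ℕ) ∉ Δ) :
    ∃ Δ', IsFanComplex n (s + 1) w Δ' := by
  have c1 : ({i, j} : Finset ℕ).card = 2 := Finset.card_pair hij
  have c2 : ({i, j, 1} : Finset ℕ).card = 3 := card_triple (by omega) (by omega) (by omega)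
  have n2 : ({i, j, 1} : Finset ℕ) ∉ insert {i, j} Δ := by
    simp only [Finset.mem_insert, not_or]
    exact ⟨ne_of_card_ne c2 c1 (by omega), notMem_triple h.complex hΔ⟩
  set Δ' := insert {i, j, 1} (insert {i, j} Δ) with hΔ'
  have hsub : Δ ⊆ Δ' := fun F hF => by simp [hΔ', hF]
  have hT : ({i, j, 1} : Finset ℕ) ∈ Δ' := by simp [hΔ']
  refine ⟨Δ', h.two_le, ?_, ?_, fun k hk hkn => hsub (h.fan k hk hkn),
    fun k hk hkn => hsub (h.cone k hk hkn), ?_, ?_, ?_, ?_⟩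
  · refine IsComplexOn.insert_triangle (h.complex.insert_edge
      (h.singleton_mem (by omega) hin) (h.singleton_mem (by omega) hjn)) ?_ ?_ ?_
    · simp
    · simp [Finset.pair_comm i 1, h.cone i hi hin]
    · simp [Finset.pair_comm j 1, h.cone j hj hjn]
  · intro F hF
    simp only [hΔ', Finset.mem_insert] at hF
    rcases hF with rfl | rfl | hF
    · omega
    · omega
    · exact h.card_le F hF
  · intro v x hv hx hvx
    simp only [hΔ', Finset.mem_insert] at hvx
    rcases hvx with e | e | e
    · exact absurd e (pair_ne_triple (by omega) (by omega) (by omega))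
    · rcases pair_eq_pair e with ⟨rfl, rfl⟩ | ⟨rfl, rfl⟩
      · exact .single ⟨by omega, by omega, by omega, hT⟩
      · refine .single ⟨by omega, by omega, by omega, ?_⟩
        convert hT using 1
        ext; simp; tauto
    · exact reach_mono hsub (h.link_connected v x hv hx e)
  all_goals
    rw [hΔ', card_facesOf_insert n2, card_facesOf_insert hΔ, c1, c2]
    have := h.card_one
    have := h.card_two
    have := h.card_three
    norm_num
    omega

/-- Glue the strip with triangles `{a, b, c}`, `{a, c, d}` along the edges `{a, b}`, `{c, d}`. -/
lemma exists_add_strip (h : IsFanComplex n s w Δ) {a b c d : ℕ} (ha : 2 ≤ a) (hb : 2 ≤ b)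
    (hc : 2 ≤ c) (hd : 2 ≤ d) (hab : a ≠ b) (hcd : c ≠ d) (hac : a ≠ c) (hbc : b ≠ c)
    (had : a ≠ d) (eab : ({a, b} : Finset ℕ) ∈ Δ) (ecd : ({c, d} : Finset ℕ) ∈ Δ)
    (nac : ({a, c} : Finset ℕ) ∉ Δ) (nbc : ({b, c} : Finset ℕ) ∉ Δ)
    (nad : ({a, d} : Finset ℕ) ∉ Δ) :
    ∃ Δ', IsFanComplex n (s + 3) (w + 1) Δ' ∧ Δ ⊆ Δ' ∧ ({b, c} : Finset ℕ) ∈ Δ' ∧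
      ∀ p q, p ≠ q → ({p, q} : Finset ℕ) ∈ Δ' → ({p, q} : Finset ℕ) ∈ Δ ∨
        ((p = a ∧ q = c) ∨ (p = c ∧ q = a)) ∨ ((p = b ∧ q = c) ∨ (p = c ∧ q = b)) ∨
        ((p = a ∧ q = d) ∨ (p = d ∧ q = a)) := by
  have hbd : b ≠ d := by rintro rfl; exact nad eab
  have eba : ({b, a} : Finset ℕ) ∈ Δ := by rwa [Finset.pair_comm]
  have edc : ({d, c} : Finset ℕ) ∈ Δ := by rwa [Finset.pair_comm]
  have sa : {a} ∈ Δ := h.complex.1 _ eab _ (by simp)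
  have sb : {b} ∈ Δ := h.complex.1 _ eab _ (by simp)
  have sc : {c} ∈ Δ := h.complex.1 _ ecd _ (by simp)
  have sd : {d} ∈ Δ := h.complex.1 _ ecd _ (by simp)
  have c1 : ({a, c} : Finset ℕ).card = 2 := Finset.card_pair hac
  have c2 : ({b, c} : Finset ℕ).card = 2 := Finset.card_pair hbc
  have c3 : ({a, d} : Finset ℕ).card = 2 := Finset.card_pair had
  have c4 : ({a, c, b} : Finset ℕ).card = 3 := card_triple hac hab hbc.symm
  have c5 : ({a, c, d} : Finset ℕ).card = 3 := card_triple hac had hcd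
  have n2 : ({b, c} : Finset ℕ) ∉ insert {a, c} Δ := by
    simp only [Finset.mem_insert, not_or]
    exact ⟨fun e => by rcases pair_eq_pair e with e | e <;> omega, nbc⟩
  have n3 : ({a, d} : Finset ℕ) ∉ insert {b, c} (insert {a, c} Δ) := by
    simp only [Finset.mem_insert, not_or]
    exact ⟨fun e => by rcases pair_eq_pair e with e | e <;> omega,
      fun e => by rcases pair_eq_pair e with e | e <;> omega, nad⟩
  have n4 : ({a, c, b} : Finset ℕ) ∉ insert {a, d} (insert {b, c} (insert {a, c} Δ)) := by
    simp only [Finset.mem_insert, not_or]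
    exact ⟨ne_of_card_ne c4 c3 (by omega), ne_of_card_ne c4 c2 (by omega),
      ne_of_card_ne c4 c1 (by omega), notMem_triple h.complex nac⟩
  have n5 : ({a, c, d} : Finset ℕ) ∉
      insert {a, c, b} (insert {a, d} (insert {b, c} (insert {a, c} Δ))) := by
    simp only [Finset.mem_insert, not_or]
    refine ⟨fun e => ?_, ne_of_card_ne c5 c3 (by omega), ne_of_card_ne c5 c2 (by omega),
      ne_of_card_ne c5 c1 (by omega), notMem_triple h.complex nac⟩
    have : d ∈ ({a, c, b} : Finset ℕ) := e ▸ (by simp)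
    simp at this
    omega
  set Δ' := insert {a, c, d} (insert {a, c, b} (insert {a, d} (insert {b, c} (insert {a, c} Δ))))
    with hΔ'
  have hsub : Δ ⊆ Δ' := fun F hF => by simp [hΔ', hF]
  have hT : ({a, c, b} : Finset ℕ) ∈ Δ' := by simp [hΔ']
  have hU : ({a, c, d} : Finset ℕ) ∈ Δ' := by simp [hΔ']
  have hpair : ∀ p q, p ≠ q → ({p, q} : Finset ℕ) ∈ Δ' → ({p, q} : Finset ℕ) ∈ Δ ∨
        ((p = a ∧ q = c) ∨ (p = c ∧ q = a)) ∨ ((p = b ∧ q = c) ∨ (p = c ∧ q = b)) ∨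
        ((p = a ∧ q = d) ∨ (p = d ∧ q = a)) := by
    intro p q hne hpq
    simp only [hΔ', Finset.mem_insert] at hpq
    rcases hpq with e | e | e | e | e | e
    · exact absurd e (pair_ne_triple hac had hcd)
    · exact absurd e (pair_ne_triple hac hab hbc.symm)
    · exact .inr (.inr (.inr (pair_eq_pair e)))
    · exact .inr (.inr (.inl (pair_eq_pair e)))
    · exact .inr (.inl (pair_eq_pair e))
    · exact Or.inl e
  refine ⟨Δ', ?_, hsub, by simp [hΔ'], hpair⟩
  have adj_a_cb : LinkAdj Δ' a c b := ⟨hac.symm, hab.symm, hbc.symm, hT⟩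
  have adj_a_dc : LinkAdj Δ' a d c := LinkAdj.symm ⟨hac.symm, had.symm, hcd, hU⟩
  have adj_c_ad : LinkAdj Δ' c a d := ⟨hac, hcd.symm, had, by rwa [Finset.insert_comm c a]⟩
  have adj_c_ba : LinkAdj Δ' c b a :=
    LinkAdj.symm ⟨hac, hbc, hab, by rwa [Finset.insert_comm c a]⟩
  have adj_b_ca : LinkAdj Δ' b c a := LinkAdj.symm ⟨hab, hbc.symm, hac, by
    rw [Finset.insert_comm b a, Finset.pair_comm b c]; exact hT⟩
  have adj_d_ac : LinkAdj Δ' d a c := ⟨had, hcd, hac, by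
    rw [Finset.insert_comm d a, Finset.pair_comm d c]; exact hU⟩
  have reach : ∀ v x, 2 ≤ v → x ≠ v → ({v, x} : Finset ℕ) ∈ Δ →
      Relation.ReflTransGen (LinkAdj Δ' v) x 1 :=
    fun v x hv hx hvx => reach_mono hsub (h.link_connected v x hv hx hvx)
  refine ⟨h.two_le, ?_, ?_, fun k hk hkn => hsub (h.fan k hk hkn),
    fun k hk hkn => hsub (h.cone k hk hkn), ?_, ?_, ?_, ?_⟩
  · refine IsComplexOn.insert_triangle (IsComplexOn.insert_triangle (IsComplexOn.insert_edge
      (IsComplexOn.insert_edge (h.complex.insert_edge sa sc) ?_ ?_) ?_ ?_) ?_ ?_ ?_) ?_ ?_ ?_ <;>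
      simp [sa, sb, sc, sd, eab, ecd, Finset.pair_comm c b]
  · intro F hF
    simp only [hΔ', Finset.mem_insert] at hF
    rcases hF with rfl | rfl | rfl | rfl | rfl | hF
    · omega
    · omega
    · omega
    · omega
    · omega
    · exact h.card_le F hF
  · intro v x hv hx hvx
    rcases hpair v x hx.symm hvx with e | (⟨rfl, rfl⟩ | ⟨rfl, rfl⟩) | (⟨rfl, rfl⟩ | ⟨rfl, rfl⟩) |
      (⟨rfl, rfl⟩ | ⟨rfl, rfl⟩)
    · exact reach v x hv hx e
    · exact .head adj_a_cb (reach _ _ ha hab.symm eab)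
    · exact .head adj_c_ad (reach _ _ hc hcd.symm ecd)
    · exact .head adj_b_ca (reach _ _ hb hab eba)
    · exact .head adj_c_ba (.head adj_c_ad (reach _ _ hc hcd.symm ecd))
    · exact .head adj_a_dc (.head adj_a_cb (reach _ _ ha hab.symm eab))
    · exact .head adj_d_ac (reach _ _ hd hcd edc)
  all_goals
    rw [hΔ', card_facesOf_insert n5, card_facesOf_insert n4, card_facesOf_insert n3,
      card_facesOf_insert n2, card_facesOf_insert nac, c1, c2, c3, c4, c5]
    have := h.card_one
    have := h.card_two
    have := h.card_three
    norm_num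
    omega

end IsFanComplex

namespace IsFanComplex

variable {n s w : ℕ} {Δ : Finset (Finset ℕ)}

lemma exists_add_three (h : IsFanComplex n s w Δ) :
    ∃ Δ', IsFanComplex (n + 3) s w Δ' ∧
      ∀ p q, n < p → 2 ≤ q → q + 2 ≤ p → ({p, q} : Finset ℕ) ∉ Δ' := by
  obtain ⟨Δ₁, h₁, m₁⟩ := h.exists_add_vertex
  obtain ⟨Δ₂, h₂, m₂⟩ := h₁.exists_add_vertex
  obtain ⟨Δ₃, h₃, m₃⟩ := h₂.exists_add_vertex
  refine ⟨Δ₃, h₃, fun p q hp hq hqp hm => ?_⟩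
  exact h.notMem_of_lt (i := p) (by simp) hp
    (m₁ p q (m₂ p q (m₃ p q hm hq hqp) hq hqp) hq hqp)

/-- Glue a strip along `{n + 1, n + 2}` and `{k, k + 1}`. -/
lemma exists_add_strip_left (h : IsFanComplex (n + 3) s w Δ) {k : ℕ} (hk : 2 ≤ k)
    (hkn : k + 2 ≤ n)
    (hm : ∀ p q, n < p → k ≤ q → q + 2 ≤ p → ({p, q} : Finset ℕ) ∉ Δ) :
    ∃ Δ', IsFanComplex (n + 3) (s + 3) (w + 1) Δ' ∧
      ∀ p q, n < p → k ≤ q → q + 2 ≤ p → ({p, q} : Finset ℕ) ∈ Δ' →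
        (p = n + 1 ∧ q = k) ∨ (p = n + 2 ∧ q = k) ∨ (p = n + 1 ∧ q = k + 1) := by
  obtain ⟨Δ', h', -, -, e⟩ := h.exists_add_strip (a := n + 1) (b := n + 2) (c := k) (d := k + 1)
    (by omega) (by omega) (by omega) (by omega) (by omega) (by omega) (by omega) (by omega)
    (by omega) (h.path_mem (by omega) (by omega)) (h.path_mem (by omega) (by omega))
    (hm _ _ (by omega) (by omega) (by omega)) (hm _ _ (by omega) (by omega) (by omega))
    (hm _ _ (by omega) (by omega) (by omega))
  refine ⟨Δ', h', fun p q hp hq hqp hpq => ?_⟩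
  have := (e p q (by omega) hpq).resolve_left (hm p q hp hq hqp)
  omega

/-- Join the new vertices `n + 1`, `n + 2`, `n + 3` to the pair `k`, `k + 1` by two strips. -/
lemma exists_add_two_strips (h : IsFanComplex (n + 3) s w Δ) {k : ℕ} (hk : 2 ≤ k)
    (hkn : k + 2 ≤ n)
    (hm : ∀ p q, n < p → k ≤ q → q + 2 ≤ p → ({p, q} : Finset ℕ) ∉ Δ) :
    ∃ Δ', IsFanComplex (n + 3) (s + 6) (w + 2) Δ' ∧
      ∀ p q, n < p → k + 2 ≤ q → q + 2 ≤ p → ({p, q} : Finset ℕ) ∉ Δ' := by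
  obtain ⟨Δ₁, h₁, e₁⟩ := h.exists_add_strip_left hk hkn hm
  have n₁ : ∀ p q, n < p → k ≤ q → q + 2 ≤ p → ¬ ((p = n + 1 ∧ q = k) ∨ (p = n + 2 ∧ q = k) ∨
      (p = n + 1 ∧ q = k + 1)) → ({p, q} : Finset ℕ) ∉ Δ₁ :=
    fun p q hp hq hqp hne hpq => hne (e₁ p q hp hq hqp hpq)
  have p₁ := h₁.path_mem (i := n + 2) (by omega) (by omega)
  have p₂ := h₁.path_mem (i := k) (by omega) (by omega)
  rw [Finset.pair_comm] at p₁ p₂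
  obtain ⟨Δ₂, h₂, -, -, e₂⟩ := h₁.exists_add_strip (a := n + 3) (b := n + 2) (c := k + 1) (d := k)
    (by omega) (by omega) (by omega) (by omega) (by omega) (by omega) (by omega) (by omega)
    (by omega) p₁ p₂
    (n₁ _ _ (by omega) (by omega) (by omega) (by omega))
    (n₁ _ _ (by omega) (by omega) (by omega) (by omega))
    (n₁ _ _ (by omega) (by omega) (by omega) (by omega))
  refine ⟨Δ₂, h₂, fun p q hp hq hqp hpq => ?_⟩
  have := (e₂ p q (by omega) hpq).resolve_left
    (n₁ p q hp (by omega) hqp (by omega))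
  omega

lemma exists_add_pairs (h : IsFanComplex n s w Δ) (t : ℕ) (ht : 2 * t + 2 ≤ n) :
    ∃ Δ', IsFanComplex (n + 3) (s + 6 * t) (w + 2 * t) Δ' ∧
      ∀ p q, n < p → 2 * t + 2 ≤ q → q + 2 ≤ p → ({p, q} : Finset ℕ) ∉ Δ' := by
  induction t with
  | zero => exact h.exists_add_three
  | succ t ih =>
    obtain ⟨Δ₁, h₁, m₁⟩ := ih (by omega)
    exact h₁.exists_add_two_strips (by omega) (by omega) m₁

/-- Adding three vertices makes room for `n - 1` strips. -/
lemma exists_add_strips (h : IsFanComplex n s w Δ) (j : ℕ) (hj : j + 1 ≤ n) :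
    ∃ Δ', IsFanComplex (n + 3) (s + 3 * j) (w + j) Δ' := by
  have hn := h.two_le
  obtain ⟨t, rfl | rfl⟩ := Nat.even_or_odd' j
  · by_cases ht : 2 * t + 2 ≤ n
    · obtain ⟨Δ', h', -⟩ := h.exists_add_pairs t ht
      exact ⟨Δ', by convert h' using 1; ring⟩
    · obtain ⟨r, rfl⟩ : ∃ r, t = r + 1 := ⟨t - 1, by omega⟩
      obtain rfl : n = 2 * r + 3 := by omega
      set k := 2 * r + 2 with hk
      obtain ⟨Δ₀, h₀, m₀⟩ := h.exists_add_pairs r (by omega)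
      have m : ∀ p q, k + 1 < p → k ≤ q → q + 2 ≤ p →
          ({p, q} : Finset ℕ) ∉ Δ₀ ∧ ({q, p} : Finset ℕ) ∉ Δ₀ := fun p q hp hq hqp => by
        rw [Finset.pair_comm q p, and_self]
        exact m₀ p q hp hq hqp
      obtain ⟨Δ₁, h₁, -, hb, e₁⟩ := h₀.exists_add_strip (a := k + 3) (b := k + 4) (c := k)
        (d := k + 1) (by omega) (by omega) (by omega) (by omega) (by omega) (by omega) (by omega)
        (by omega) (by omega) (h₀.path_mem (by omega) (by omega))
        (h₀.path_mem (by omega) (by omega))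
        (m _ _ (by omega) (by omega) (by omega)).1 (m _ _ (by omega) (by omega) (by omega)).1
        (m _ _ (by omega) (by omega) (by omega)).1
      have p₁ := h₁.path_mem (i := k + 1) (by omega) (by omega)
      rw [Finset.pair_comm] at p₁
      obtain ⟨Δ₂, h₂, -⟩ := h₁.exists_add_strip (a := k + 4) (b := k) (c := k + 2)
        (d := k + 1) (by omega) (by omega) (by omega) (by omega) (by omega) (by omega) (by omega)
        (by omega) (by omega) hb p₁
        (fun hm => by
          have := (e₁ _ _ (by omega) hm).resolve_left (m _ _ (by omega) (by omega) (by omega)).1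
          omega)
        (fun hm => by
          have := (e₁ _ _ (by omega) hm).resolve_left (m _ _ (by omega) (by omega) (by omega)).2
          omega)
        (fun hm => by
          have := (e₁ _ _ (by omega) hm).resolve_left (m _ _ (by omega) (by omega) (by omega)).1
          omega)
      exact ⟨Δ₂, by convert h₂ using 1 <;> ring⟩
  · obtain ⟨Δ₀, h₀, m₀⟩ := h.exists_add_pairs t (by omega)
    by_cases ht : 2 * t + 4 ≤ n
    · obtain ⟨Δ', h', -⟩ := h₀.exists_add_strip_left (by omega) (by omega) m₀
      exact ⟨Δ', by convert h' using 1 <;> ring⟩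
    · by_cases hn2 : n = 2 * t + 2
      · have m : ∀ p q, n < p → n ≤ q → q + 2 ≤ p → ({q, p} : Finset ℕ) ∉ Δ₀ :=
          fun p q hp hq hqp => by
            rw [Finset.pair_comm q p]
            exact m₀ p q hp (by omega) hqp
        have p₁ := h₀.path_mem (i := n + 2) (by omega) (by omega)
        rw [Finset.pair_comm] at p₁
        obtain ⟨Δ', h', -⟩ := h₀.exists_add_strip (a := n) (b := n + 1) (c := n + 3)
          (d := n + 2) (by omega) (by omega) (by omega) (by omega) (by omega) (by omega) (by omega)
          (by omega) (by omega) (h₀.path_mem (by omega) (by omega)) p₁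
          (m _ _ (by omega) (by omega) (by omega)) (m _ _ (by omega) (by omega) (by omega))
          (m _ _ (by omega) (by omega) (by omega))
        exact ⟨Δ', by convert h' using 1 <;> ring⟩
      · obtain rfl : n = 2 * t + 3 := by omega
        set k := 2 * t + 2 with hk
        obtain ⟨Δ', h', -⟩ := h₀.exists_add_strip (a := k + 3) (b := k + 4) (c := k)
          (d := k + 1) (by omega) (by omega) (by omega) (by omega) (by omega) (by omega)
          (by omega) (by omega) (by omega) (h₀.path_mem (by omega) (by omega))
          (h₀.path_mem (by omega) (by omega))
          (m₀ _ _ (by omega) (by omega) (by omega)) (m₀ _ _ (by omega) (by omega) (by omega))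
          (m₀ _ _ (by omega) (by omega) (by omega))
        exact ⟨Δ', by convert h' using 1 <;> ring⟩

/-- Complexes all of whose vertex links are trees. -/
lemma exists_linkAcyclic (k w : ℕ) (hw : 3 * w ≤ k.choose 2) :
    ∃ Δ, IsFanComplex (k + 2) (3 * w) w Δ := by
  induction k using Nat.strong_induction_on generalizing w with
  | _ k ih =>
    rcases (by omega : k = 0 ∨ k = 1 ∨ k = 2 ∨ 3 ≤ k) with rfl | rfl | rfl | hk
    · obtain rfl : w = 0 := by simpa using hw
      exact ⟨_, isFanComplex_two⟩
    · obtain rfl : w = 0 := by simpa using hw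
      obtain ⟨Δ, h, -⟩ := isFanComplex_two.exists_add_vertex
      exact ⟨Δ, h⟩
    · obtain rfl : w = 0 := by
        rw [Nat.choose_self] at hw
        omega
      obtain ⟨_, h, -⟩ := isFanComplex_two.exists_add_vertex
      obtain ⟨Δ, h, -⟩ := h.exists_add_vertex
      exact ⟨Δ, h⟩
    · obtain ⟨m, rfl⟩ : ∃ m, k = m + 3 := ⟨k - 3, by omega⟩
      have hc : (m + 3).choose 2 = m.choose 2 + 3 * (m + 1) := by
        simp [Nat.choose_succ_succ]
        ring
      have hle : 3 * (m.choose 2 / 3) ≤ m.choose 2 := Nat.mul_div_le _ _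
      rcases le_total w (m.choose 2 / 3) with hw' | hw'
      · obtain ⟨Δ, h⟩ := ih m (by omega) w (by omega)
        obtain ⟨Δ', h', -⟩ := h.exists_add_three
        exact ⟨Δ', h'⟩
      · obtain ⟨Δ, h⟩ := ih m (by omega) _ hle
        obtain ⟨Δ', h'⟩ := h.exists_add_strips (w - m.choose 2 / 3) (by omega)
        refine ⟨Δ', ?_⟩
        convert h' using 1 <;> omega

lemma exists_missing_edge (h : IsFanComplex n s w Δ) (hs : s < (n - 2).choose 2) :
    ∃ i j, 2 ≤ i ∧ i ≤ n ∧ 2 ≤ j ∧ j ≤ n ∧ i ≠ j ∧ ({i, j} : Finset ℕ) ∉ Δ := by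
  by_contra! hcon
  have hsub : (Finset.Icc 1 n).powersetCard 2 ⊆ facesOf Δ 2 := by
    intro F hF
    obtain ⟨hF1, hF2⟩ := Finset.mem_powersetCard.1 hF
    refine Finset.mem_filter.2 ⟨?_, hF2⟩
    obtain ⟨i, j, hij, rfl⟩ := Finset.card_eq_two.1 hF2
    have hi := Finset.mem_Icc.1 (hF1 (by simp : i ∈ _))
    have hj := Finset.mem_Icc.1 (hF1 (by simp : j ∈ _))
    by_cases hi1 : i = 1
    · subst hi1
      exact h.cone j (by omega) hj.2
    · by_cases hj1 : j = 1
      · subst hj1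
        rw [Finset.pair_comm]
        exact h.cone i (by omega) hi.2
      · exact hcon i j (by omega) hi.2 (by omega) hj.2 hij
  have hle := Finset.card_le_card hsub
  rw [Finset.card_powersetCard, Nat.card_Icc, Nat.add_sub_cancel] at hle
  obtain ⟨m, rfl⟩ : ∃ m, n = m + 2 := ⟨n - 2, by have := h.two_le; omega⟩
  have hc : (m + 2).choose 2 = m.choose 2 + 2 * m + 1 := by
    simp [Nat.choose_succ_succ]
    ring
  have := h.card_two
  rw [Nat.add_sub_cancel] at hs
  omega

lemma exists_add_edges (h : IsFanComplex n s w Δ) (r : ℕ) (hr : s + r ≤ (n - 2).choose 2) :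
    ∃ Δ', IsFanComplex n (s + r) w Δ' := by
  induction r with
  | zero => exact ⟨Δ, h⟩
  | succ r ih =>
    obtain ⟨Δ₁, h₁⟩ := ih (by omega)
    obtain ⟨i, j, hi, hin, hj, hjn, hij, hm⟩ := h₁.exists_missing_edge (by omega)
    exact h₁.exists_add_edge hi hin hj hjn hij hm

end IsFanComplex

section Homology

variable (K : Type) [Field K] {Γ : Finset (Finset ℕ)}

lemma bdry_single (F : Finset ℕ) : bdry K (Finsupp.single F 1) =
    ∑ v ∈ F, ((-1 : K) ^ ((F.filter fun u => u < v).card)) • Finsupp.single (F.erase v) (1 : K) := by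
  simp [bdry]

lemma single_mem_chains {F : Finset ℕ} (hF : F ∈ Γ) :
    Finsupp.single F (1 : K) ∈ chains K Γ F.card :=
  Submodule.subset_span ⟨F, by simp [facesOf, hF], rfl⟩

instance (m : ℕ) : FiniteDimensional K (chains K Γ m) :=
  FiniteDimensional.span_of_finite K ((facesOf Γ m).finite_toSet.image _)

lemma homDim_eq_zero_of_le {m : ℕ}
    (h : chains K Γ m ⊓ LinearMap.ker (bdry K) ≤ (chains K Γ (m + 1)).map (bdry K)) :
    homDim K Γ m = 0 :=
  Nat.sub_eq_zero_of_le (Submodule.finrank_mono h)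

lemma homDim_eq_zero_of_card_ne {m : ℕ} (h : ∀ F ∈ Γ, F.card ≠ m) : homDim K Γ m = 0 := by
  refine homDim_eq_zero_of_le K (inf_le_left.trans ?_)
  have : facesOf Γ m = ∅ := Finset.filter_eq_empty_iff.2 h
  simp [chains, this]

lemma bdry_single_vertex (x : ℕ) :
    bdry K (Finsupp.single {x} 1) = Finsupp.single ∅ 1 := by
  rw [bdry_single, Finset.sum_singleton]
  simp [Finset.filter_singleton]

lemma homDim_zero_eq_zero {x : ℕ} (hx : {x} ∈ Γ) : homDim K Γ 0 = 0 := by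
  have hmem : Finsupp.single {x} (1 : K) ∈ chains K Γ (0 + 1) := by
    simpa only [Finset.card_singleton, zero_add] using single_mem_chains K hx
  have himage : Finsupp.single ∅ (1 : K) ∈ (chains K Γ (0 + 1)).map (bdry K) :=
    bdry_single_vertex K x ▸ Submodule.mem_map_of_mem hmem
  refine homDim_eq_zero_of_le K (inf_le_left.trans (Submodule.span_le.2 ?_))
  rintro _ ⟨F, hF, rfl⟩
  have hF0 : F = ∅ := Finset.card_eq_zero.1 (Finset.mem_filter.1 hF).2
  simpa only [hF0, SetLike.mem_coe] using himage

lemma single_sub_single_mem_of_lt {a b : ℕ} (hab : a < b) (h : {a, b} ∈ Γ) :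
    Finsupp.single {b} (1 : K) - Finsupp.single {a} 1 ∈ (chains K Γ 2).map (bdry K) := by
  refine ⟨_, Finset.card_pair hab.ne ▸ single_mem_chains K h, ?_⟩
  have e1 : ({a, b} : Finset ℕ).erase a = {b} := by ext; simp; omega
  have e2 : ({a, b} : Finset ℕ).erase b = {a} := by ext; simp; omega
  have f1 : ({a, b} : Finset ℕ).filter (· < a) = ∅ := by ext; simp; omega
  have f2 : ({a, b} : Finset ℕ).filter (· < b) = {a} := by ext; simp; omega
  rw [bdry_single, Finset.sum_pair hab.ne, e1, e2, f1, f2]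
  simp [sub_eq_add_neg]

lemma single_sub_single_mem_of_reach {x y : ℕ}
    (h : Relation.ReflTransGen (fun p q : ℕ => p ≠ q ∧ ({p, q} : Finset ℕ) ∈ Γ) x y) :
    Finsupp.single {x} (1 : K) - Finsupp.single {y} 1 ∈ (chains K Γ 2).map (bdry K) := by
  induction h with
  | refl => simp
  | @tail b c _ hbc ih =>
    have key : Finsupp.single {b} (1 : K) - Finsupp.single {c} 1 ∈
        (chains K Γ 2).map (bdry K) := by
      rcases lt_or_gt_of_ne hbc.1 with hlt | hlt
      · rw [← neg_sub]
        exact neg_mem (single_sub_single_mem_of_lt K hlt hbc.2)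
      · exact single_sub_single_mem_of_lt K hlt (Finset.pair_comm b c ▸ hbc.2)
    simpa using add_mem ih key

lemma homDim_one_eq_zero {y : ℕ} (h : ∀ x, {x} ∈ Γ →
    Relation.ReflTransGen (fun p q : ℕ => p ≠ q ∧ ({p, q} : Finset ℕ) ∈ Γ) x y) :
    homDim K Γ 1 = 0 := by
  have key : ∀ c ∈ chains K Γ 1, ∃ e : K, bdry K c = Finsupp.single ∅ e ∧
      c - e • Finsupp.single {y} (1 : K) ∈ (chains K Γ 2).map (bdry K) := by
    intro c hc
    induction hc using Submodule.span_induction with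
    | mem c hc =>
      obtain ⟨F, hF, rfl⟩ := hc
      obtain ⟨hF1, hF2⟩ := Finset.mem_filter.1 hF
      obtain ⟨x, rfl⟩ := Finset.card_eq_one.1 hF2
      refine ⟨1, bdry_single_vertex K x, ?_⟩
      rw [one_smul]
      exact single_sub_single_mem_of_reach K (h x hF1)
    | zero => exact ⟨0, by simp⟩
    | add c d _ _ hc hd =>
      obtain ⟨e, he, he'⟩ := hc
      obtain ⟨f, hf, hf'⟩ := hd
      refine ⟨e + f, by rw [map_add, he, hf, Finsupp.single_add], ?_⟩
      rw [add_smul, add_sub_add_comm]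
      exact add_mem he' hf'
    | smul a c _ hc =>
      obtain ⟨e, he, he'⟩ := hc
      refine ⟨a * e, by rw [map_smul, he, Finsupp.smul_single, smul_eq_mul], ?_⟩
      rw [mul_smul, ← smul_sub]
      exact Submodule.smul_mem _ a he'
  refine homDim_eq_zero_of_le K fun c hc => ?_
  obtain ⟨e, he, he'⟩ := key c hc.1
  have h0 : Finsupp.single (∅ : Finset ℕ) e = 0 := he ▸ LinearMap.mem_ker.1 hc.2
  rw [Finsupp.single_eq_zero] at h0
  simpa [h0] using he'

lemma mem_link {F G : Finset ℕ} : G ∈ link Γ F ↔ G ∈ Γ ∧ Disjoint G F ∧ G ∪ F ∈ Γ :=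
  Finset.mem_filter

/-- Connected graphs without isolated vertices are Cohen–Macaulay. -/
lemma isCohenMacaulay_of_connected_graph (hcard : ∀ F ∈ Γ, F.card ≤ 2)
    (hedge : ∀ x, {x} ∈ Γ → ∃ z, z ≠ x ∧ {z} ∈ Γ ∧ {z, x} ∈ Γ) {y : ℕ} (hy : {y} ∈ Γ)
    (h : ∀ x, {x} ∈ Γ →
      Relation.ReflTransGen (fun p q : ℕ => p ≠ q ∧ ({p, q} : Finset ℕ) ∈ Γ) x y) :
    IsCohenMacaulay K Γ := by
  have hsup : Γ.sup Finset.card = 2 := by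
    obtain ⟨z, hz, -, hzy⟩ := hedge y hy
    exact le_antisymm (Finset.sup_le hcard) (Finset.card_pair hz ▸ Finset.le_sup hzy)
  intro F hF i hi
  rw [dimZ, hsup] at hi
  unfold betti
  split_ifs with h0
  swap
  · rfl
  obtain ⟨m, hm⟩ := Int.eq_ofNat_of_zero_le h0
  rw [hm, Int.toNat_natCast]
  have hmF : m + F.card ≠ 2 := by
    push_cast at hi
    omega
  have hlarge : 2 < m + F.card → homDim K (link Γ F) m = 0 := fun hlt =>
    homDim_eq_zero_of_card_ne K fun G hG hGm => by
      obtain ⟨-, hd, hu⟩ := mem_link.1 hG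
      have := hcard _ hu
      rw [Finset.card_union_of_disjoint hd] at this
      omega
  rcases lt_or_gt_of_ne hmF with hlt | hlt
  swap
  · exact hlarge hlt
  have hF2 : F.card = 0 ∨ F.card = 1 := by omega
  rcases hF2 with hF2 | hF2
  · obtain rfl := Finset.card_eq_zero.1 hF2
    have hl : link Γ ∅ = Γ := by
      ext G
      simp [mem_link]
    rw [hl]
    rcases (by omega : m = 0 ∨ m = 1) with rfl | rfl
    · exact homDim_zero_eq_zero K hy
    · exact homDim_one_eq_zero K h
  · obtain ⟨x, rfl⟩ := Finset.card_eq_one.1 hF2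
    obtain rfl : m = 0 := by omega
    obtain ⟨z, hz, hz1, hzx⟩ := hedge x hF
    refine homDim_zero_eq_zero K (x := z) (mem_link.2 ⟨hz1, by simpa using hz, ?_⟩)
    simpa using hzx

end Homology

namespace IsFanComplex

variable {n s w : ℕ} {Δ : Finset (Finset ℕ)}

lemma vertex_bounds (h : IsFanComplex n s w Δ) {i : ℕ} {F : Finset ℕ} (hF : F ∈ Δ) (hi : i ∈ F) :
    1 ≤ i ∧ i ≤ n :=
  Finset.mem_Icc.1 (h.complex.2.1 F hF i hi)

lemma exists_linkAdj_one (h : IsFanComplex n s w Δ) (hn : 3 ≤ n) {v : ℕ} (hv : 2 ≤ v)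
    (hvn : v ≤ n) : ∃ u, LinkAdj Δ 1 u v := by
  rcases Nat.lt_or_ge v n with hlt | hge
  · exact ⟨v + 1, LinkAdj.symm ⟨by omega, by omega, by omega, h.fan v hv hlt⟩⟩
  · obtain ⟨u, rfl⟩ : ∃ u, v = u + 1 := ⟨v - 1, by omega⟩
    exact ⟨u, by omega, by omega, by omega, h.fan u (by omega) (by omega)⟩

/-- Every edge `{v, x}` lies in a triangle. -/
lemma exists_linkAdj (h : IsFanComplex n s w Δ) (hn : 3 ≤ n) {v x : ℕ} (hvx : x ≠ v)
    (hm : ({v, x} : Finset ℕ) ∈ Δ) : ∃ u, LinkAdj Δ v u x := by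
  have hv := h.vertex_bounds hm (i := v) (by simp)
  have hx := h.vertex_bounds hm (i := x) (by simp)
  by_cases hv1 : v = 1
  · subst hv1
    exact h.exists_linkAdj_one hn (by omega) hx.2
  · by_cases hx1 : x = 1
    · subst hx1
      obtain ⟨u, hu1, hu2, hu3, hu⟩ := h.exists_linkAdj_one hn (by omega) hv.2
      refine ⟨u, hu3, hvx, hu1, ?_⟩
      convert hu using 1
      ext; simp; tauto
    · rcases (h.link_connected v x (by omega) hvx hm).cases_head with e | ⟨u, hu, -⟩
      · exact absurd e hx1
      · exact ⟨u, hu.symm⟩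

lemma exists_edge (h : IsFanComplex n s w Δ) {v : ℕ} (hv : {v} ∈ Δ) :
    ∃ x, x ≠ v ∧ ({v, x} : Finset ℕ) ∈ Δ := by
  have hb := h.vertex_bounds hv (i := v) (by simp)
  by_cases hv1 : v = 1
  · subst hv1
    exact ⟨2, by omega, h.cone 2 le_rfl h.two_le⟩
  · exact ⟨1, Ne.symm hv1, Finset.pair_comm 1 v ▸ h.cone v (by omega) hb.2⟩

lemma exists_triangle (h : IsFanComplex n s w Δ) (hn : 3 ≤ n) {F : Finset ℕ} (hF : F ∈ Δ) :
    ∃ T ∈ Δ, F ⊆ T ∧ T.card = 3 := by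
  have edge : ∀ v x, x ≠ v → ({v, x} : Finset ℕ) ∈ Δ →
      ∃ T ∈ Δ, ({v, x} : Finset ℕ) ⊆ T ∧ T.card = 3 := fun v x hvx hm => by
    obtain ⟨u, hu1, hu2, hu3, hu⟩ := h.exists_linkAdj hn hvx hm
    exact ⟨_, hu, by intro y; simp; tauto, card_triple hu1.symm hu2.symm hu3⟩
  have vertex : ∀ v, {v} ∈ Δ → ∃ T ∈ Δ, ({v} : Finset ℕ) ⊆ T ∧ T.card = 3 := fun v hv => by
    obtain ⟨x, hx, hm⟩ := h.exists_edge hv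
    obtain ⟨T, hT, hs, hc⟩ := edge v x hx hm
    exact ⟨T, hT, (by simp : ({v} : Finset ℕ) ⊆ {v, x}).trans hs, hc⟩
  have := h.card_le F hF
  rcases (by omega : F.card = 0 ∨ F.card = 1 ∨ F.card = 2 ∨ F.card = 3) with hc | hc | hc | hc
  · obtain ⟨T, hT, -, hc'⟩ := vertex 1 (h.singleton_mem le_rfl (by omega))
    exact ⟨T, hT, by simp [Finset.card_eq_zero.1 hc], hc'⟩
  · obtain ⟨v, rfl⟩ := Finset.card_eq_one.1 hc
    exact vertex v hF
  · obtain ⟨v, x, hvx, rfl⟩ := Finset.card_eq_two.1 hc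
    exact edge v x hvx.symm hF
  · exact ⟨F, hF, subset_rfl, hc⟩

lemma sup_card (h : IsFanComplex n s w Δ) (hn : 3 ≤ n) : Δ.sup Finset.card = 3 := by
  obtain ⟨T, hT, -, hc⟩ := h.exists_triangle hn h.empty_mem
  exact le_antisymm (Finset.sup_le h.card_le) (hc ▸ Finset.le_sup hT)

lemma isPure (h : IsFanComplex n s w Δ) (hn : 3 ≤ n) : IsPure Δ := by
  intro F hF hmax
  obtain ⟨T, hT, hFT, hc⟩ := h.exists_triangle hn hF
  rw [h.sup_card hn, hmax T hT hFT, hc]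

lemma isConnectedComplex (h : IsFanComplex n s w Δ) : IsConnectedComplex Δ := by
  intro u v hu hv
  have hub := h.vertex_bounds hu (i := u) (by simp)
  have hvb := h.vertex_bounds hv (i := v) (by simp)
  refine Relation.ReflTransGen.trans (b := 1) ?_ ?_
  · by_cases hu1 : u = 1
    · rw [hu1]
    · exact .single ⟨hu1, Finset.pair_comm 1 u ▸ h.cone u (by omega) hub.2⟩
  · by_cases hv1 : v = 1
    · rw [hv1]
    · exact .single ⟨Ne.symm hv1, h.cone v (by omega) hvb.2⟩

lemma singleton_mem_link (h : IsFanComplex n s w Δ) {v x : ℕ} :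
    {x} ∈ link Δ {v} ↔ x ≠ v ∧ ({v, x} : Finset ℕ) ∈ Δ := by
  rw [mem_link, Finset.disjoint_singleton, Finset.pair_comm v x]
  exact ⟨fun ⟨_, h1, h2⟩ => ⟨h1, h2⟩, fun ⟨h1, h2⟩ => ⟨h.complex.1 _ h2 _ (by simp), h1, h2⟩⟩

lemma _root_.LinkAdj.pair_mem_link (h : IsFanComplex n s w Δ) {v p q : ℕ} (hl : LinkAdj Δ v p q) :
    {p, q} ∈ link Δ {v} := by
  obtain ⟨h1, h2, h3, h4⟩ := hl
  refine mem_link.2 ⟨h.complex.1 _ h4 _ (by simp), by simp [h1.symm, h2.symm], ?_⟩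
  convert h4 using 1
  ext; simp; tauto

lemma reach_two (h : IsFanComplex n s w Δ) {x : ℕ} (hx : 2 ≤ x) (hxn : x ≤ n) :
    Relation.ReflTransGen (LinkAdj Δ 1) x 2 := by
  induction x, hx using Nat.le_induction with
  | base => exact .refl
  | succ x hx ih =>
    exact .head (LinkAdj.symm ⟨by omega, by omega, by omega, h.fan x hx hxn⟩) (ih (by omega))

lemma exists_link_center (h : IsFanComplex n s w Δ) {v : ℕ} (hv : {v} ∈ Δ) :
    ∃ y, y ≠ v ∧ ({v, y} : Finset ℕ) ∈ Δ ∧ ∀ x, x ≠ v → ({v, x} : Finset ℕ) ∈ Δ →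
      Relation.ReflTransGen (LinkAdj Δ v) x y := by
  have hb := h.vertex_bounds hv (i := v) (by simp)
  by_cases hv1 : v = 1
  · subst hv1
    refine ⟨2, by omega, h.cone 2 le_rfl h.two_le, fun x hx hm => ?_⟩
    have hxb := h.vertex_bounds hm (i := x) (by simp)
    exact h.reach_two (by omega) hxb.2
  · exact ⟨1, Ne.symm hv1, Finset.pair_comm 1 v ▸ h.cone v (by omega) hb.2,
      fun x hx hm => h.link_connected v x (by omega) hx hm⟩

lemma isBuchsbaum (K : Type) [Field K] (h : IsFanComplex n s w Δ) (hn : 3 ≤ n) :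
    IsBuchsbaum K Δ := by
  refine ⟨h.isPure hn, fun v hv => ?_⟩
  obtain ⟨y, hy, hvy, hreach⟩ := h.exists_link_center hv
  refine isCohenMacaulay_of_connected_graph K (fun F hF => ?_) (fun x hx => ?_)
    (h.singleton_mem_link.2 ⟨hy, hvy⟩) fun x hx => ?_
  · obtain ⟨-, hd, hu⟩ := mem_link.1 hF
    have := h.card_le _ hu
    rw [Finset.card_union_of_disjoint hd, Finset.card_singleton] at this
    omega
  · obtain ⟨hxv, hm⟩ := h.singleton_mem_link.1 hx
    obtain ⟨z, hz⟩ := h.exists_linkAdj hn hxv hm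
    refine ⟨z, hz.2.2.1, h.singleton_mem_link.2 ⟨hz.1, ?_⟩, hz.pair_mem_link h⟩
    exact h.complex.1 _ hz.2.2.2 _ (by intro a; simp; tauto)
  · obtain ⟨hxv, hm⟩ := h.singleton_mem_link.1 hx
    exact Relation.ReflTransGen.mono (fun _ _ hab => ⟨hab.2.2.1, hab.pair_mem_link h⟩) _ _
      (hreach x hxv hm)

lemma hVector3_sub_three {k : ℕ} (h : IsFanComplex (k + 3) s w Δ) :
    hVector3 Δ 1 (k : ℤ) (s : ℤ) (-(w : ℤ)) := by
  have h1 := h.card_one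
  have h2 := h.card_two
  have h3 := h.card_three
  refine ⟨?_, ?_, ?_, ?_⟩ <;>
    simp [hVec, Finset.sum_range_succ, fVec] <;> omega

end IsFanComplex

/-- **Proposition 2.2.** For positive integers `h1, h2, w` with `3w ≤ h2 ≤ C(h1+1,2)`
there is a `2`-dimensional connected Buchsbaum complex with `h`-vector `(1,h1,h2,-w)`. -/
theorem stmt3 (K : Type) [Field K] (h1 h2 w : ℕ)
    (hh1 : 0 < h1) (hh2 : 0 < h2) (hw : 0 < w)
    (h3w : 3 * w ≤ h2) (hup : h2 ≤ (h1 + 1).choose 2) :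
    ∃ (n : ℕ) (Δ : Finset (Finset ℕ)), IsComplexOn n Δ ∧ dimZ Δ = 2 ∧
      IsConnectedComplex Δ ∧ IsBuchsbaum K Δ ∧
      hVector3 Δ 1 (h1 : ℤ) (h2 : ℤ) (-(w : ℤ)) := by
  obtain ⟨Δ₀, h₀⟩ := IsFanComplex.exists_linkAcyclic (h1 + 1) w (h3w.trans hup)
  obtain ⟨Δ, h⟩ := h₀.exists_add_edges (h2 - 3 * w) (by
    rw [Nat.add_sub_cancel]
    omega)
  rw [Nat.add_sub_cancel' h3w] at h
  refine ⟨h1 + 3, Δ, h.complex, ?_, h.isConnectedComplex, h.isBuchsbaum K (by omega),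
    h.hVector3_sub_three⟩
  rw [dimZ, h.sup_card (by omega)]
  rfl
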